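/- Every eigenvalue λ of 𝒫̂_SP^{−1}𝒜_SP is real and satisfies λ ∈ [λ_−(α_E^{(0)}, β_E^{(1)}, β_R^{(1)}), λ_−(β_E^{(0)}, α_E^{(1)}, α_R^{(1)})] ∪ [α_E^{(0)}, λ_+(β_E^{(0)}, α_E^{(1)}, β_R^{(1)})], where λ_±(a, b, c) = (a − b)/2 ± sqrt((a + b)²/4 + c). -/

import Mathlib

noncomputable section
open Matrix

/-- `λ₋(a,b,c) = (a-b)/2 - √((a+b)²/4 + c)`. -/
def lamM (a b c : ℝ) : ℝ := (a - b) / 2 - Real.sqrt ((a + b)^2 / 4 + c)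

/-- `λ₊(a,b,c) = (a-b)/2 + √((a+b)²/4 + c)`. -/
def lamP (a b c : ℝ) : ℝ := (a - b) / 2 + Real.sqrt ((a + b)^2 / 4 + c)

lemma Matrix.IsHermitian.dotProduct_mulVec_swap {ι : Type*} [Fintype ι] {E : Matrix ι ι ℝ}
    (hE : E.IsHermitian) (x y : ι → ℝ) : x ⬝ᵥ E *ᵥ y = y ⬝ᵥ E *ᵥ x := by
  have hT : Eᵀ = E := by simpa [IsHermitian, conjTranspose] using hE
  rw [dotProduct_mulVec, ← mulVec_transpose, hT, dotProduct_comm]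

/-- Rayleigh quotient lower bound. -/
lemma Matrix.IsHermitian.mul_dotProduct_le {ι : Type*} [Fintype ι] [DecidableEq ι]
    {E : Matrix ι ι ℝ} (hE : E.IsHermitian) {a : ℝ} (ha : ∀ i, a ≤ hE.eigenvalues i)
    (x : ι → ℝ) : a * (x ⬝ᵥ x) ≤ x ⬝ᵥ E *ᵥ x := by
  have h : (E - algebraMap ℝ _ a).PosSemidef := by
    rw [posSemidef_iff_isHermitian_and_spectrum_nonneg]
    refine ⟨hE.sub ?_, ?_⟩
    · simp [IsHermitian, algebraMap_eq_diagonal]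
    · rw [← spectrum.sub_singleton_eq, hE.spectrum_real_eq_range_eigenvalues]
      rintro _ ⟨_, ⟨i, rfl⟩, _, rfl, rfl⟩
      simpa using ha i
  have := h.dotProduct_mulVec_nonneg x
  simp [sub_mulVec, Algebra.algebraMap_eq_smul_one, smul_mulVec] at this
  exact this

/-- Rayleigh quotient upper bound. -/
lemma Matrix.IsHermitian.dotProduct_le_mul {ι : Type*} [Fintype ι] [DecidableEq ι]
    {E : Matrix ι ι ℝ} (hE : E.IsHermitian) {b : ℝ} (hb : ∀ i, hE.eigenvalues i ≤ b)
    (x : ι → ℝ) : x ⬝ᵥ E *ᵥ x ≤ b * (x ⬝ᵥ x) := by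
  have h : (algebraMap ℝ _ b - E).PosSemidef := by
    rw [posSemidef_iff_isHermitian_and_spectrum_nonneg]
    refine ⟨IsHermitian.sub ?_ hE, ?_⟩
    · simp [IsHermitian, algebraMap_eq_diagonal]
    · rw [← spectrum.singleton_sub_eq, hE.spectrum_real_eq_range_eigenvalues]
      rintro _ ⟨_, rfl, _, ⟨i, rfl⟩, rfl⟩
      simpa using hb i
  have := h.dotProduct_mulVec_nonneg x
  simp [sub_mulVec, Algebra.algebraMap_eq_smul_one, smul_mulVec] at this
  exact this

lemma dotProduct_self_pos_of_ne_zero {ι : Type*} [Fintype ι] {x : ι → ℝ} (hx : x ≠ 0) :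
    0 < x ⬝ᵥ x :=
  lt_of_le_of_ne (by simpa using dotProduct_star_self_nonneg x)
    (fun h => hx (dotProduct_self_eq_zero.mp h.symm))

lemma dotProduct_self_nonneg_real {ι : Type*} [Fintype ι] (x : ι → ℝ) : 0 ≤ x ⬝ᵥ x := by
  simpa using dotProduct_star_self_nonneg x

/-- A real number at which the quadratic `(x - a) (x + b) - c` is nonpositive is at least
`lamM a b c`. -/
lemma lamM_le_of_mul_le {a b c x : ℝ} (h : (x - a) * (x + b) ≤ c) : lamM a b c ≤ x := by
  have := Real.abs_le_sqrt (x := x - (a - b) / 2) (y := (a + b) ^ 2 / 4 + c) (by nlinarith)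
  have := neg_le_of_abs_le this
  unfold lamM; linarith

lemma le_lamP_of_mul_le {a b c x : ℝ} (h : (x - a) * (x + b) ≤ c) : x ≤ lamP a b c := by
  have := Real.abs_le_sqrt (x := x - (a - b) / 2) (y := (a + b) ^ 2 / 4 + c) (by nlinarith)
  have := le_of_abs_le this
  unfold lamP; linarith

lemma le_lamM_of_le_mul {a b c x : ℝ} (hc : 0 ≤ c) (hx : x < a)
    (h : c ≤ (x - a) * (x + b)) : x ≤ lamM a b c := by
  have hxb : x + b ≤ 0 := by
    by_contra! hcon
    nlinarith
  have : Real.sqrt ((a + b) ^ 2 / 4 + c) ≤ (a - b) / 2 - x := by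
    apply Real.sqrt_le_iff.mpr
    constructor
    · linarith
    · nlinarith
  unfold lamM; linarith

/-- Eigenvalue bounds for a symmetrically preconditioned saddle point matrix, in terms of Rayleigh
quotient bounds for its blocks. -/
lemma saddle_eigenvalue_bounds {m n : Type*} [Fintype m] [Fintype n]
    {E : Matrix n n ℝ} {F : Matrix m m ℝ} {R : Matrix m n ℝ}
    (hE : E.IsHermitian)
    {a b c d p q : ℝ}
    (ha : ∀ x, a * (x ⬝ᵥ x) ≤ x ⬝ᵥ E *ᵥ x) (hb : ∀ x, x ⬝ᵥ E *ᵥ x ≤ b * (x ⬝ᵥ x))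
    (hc : ∀ x, c * (x ⬝ᵥ x) ≤ x ⬝ᵥ F *ᵥ x) (hd : ∀ x, x ⬝ᵥ F *ᵥ x ≤ d * (x ⬝ᵥ x))
    (hp : ∀ y, p * (y ⬝ᵥ y) ≤ (Rᵀ *ᵥ y) ⬝ᵥ (Rᵀ *ᵥ y))
    (hq : ∀ y, (Rᵀ *ᵥ y) ⬝ᵥ (Rᵀ *ᵥ y) ≤ q * (y ⬝ᵥ y))
    (hab : a ≤ b) (ha0 : 0 ≤ a) (hc0 : 0 ≤ c) (hp0 : 0 ≤ p) (hq0 : 0 ≤ q)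
    {r : ℝ} {u : n → ℝ} {w : m → ℝ} (huw : u ≠ 0 ∨ w ≠ 0)
    (h1 : E *ᵥ u + Rᵀ *ᵥ w = r • u) (h2 : R *ᵥ u - F *ᵥ w = r • w) :
    (lamM a d q ≤ r ∧ r ≤ lamM b c p) ∨ (a ≤ r ∧ r ≤ lamP b c q) := by
  have hRw : Rᵀ *ᵥ w = r • u - E *ᵥ u := by rw [← h1]; simp
  have hRu : R *ᵥ u = r • w + F *ᵥ w := by rw [← h2]; simp
  have hadj : ∀ y, u ⬝ᵥ Rᵀ *ᵥ y = y ⬝ᵥ R *ᵥ u := fun y => by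
    rw [dotProduct_mulVec, vecMul_transpose, dotProduct_comm]
  have key : r * (w ⬝ᵥ w) + w ⬝ᵥ F *ᵥ w = r * (u ⬝ᵥ u) - u ⬝ᵥ E *ᵥ u := by
    have h := hadj w
    rw [hRw, hRu] at h
    simp only [dotProduct_add, dotProduct_sub, dotProduct_smul, smul_eq_mul] at h
    linarith
  rcases lt_or_ge r a with hra | hra
  · left
    have hw : w ≠ 0 := by
      rintro rfl
      have hu : u ≠ 0 := by simpa using huw
      have := dotProduct_self_pos_of_ne_zero hu
      have := ha u
      simp at key
      nlinarith
    have hww := dotProduct_self_pos_of_ne_zero hw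
    set z := E *ᵥ u - r • u with hz
    have hzR : (Rᵀ *ᵥ w) ⬝ᵥ (Rᵀ *ᵥ w) = z ⬝ᵥ z := by
      rw [hRw, ← neg_sub, neg_dotProduct_neg]
    have huz : u ⬝ᵥ z = u ⬝ᵥ E *ᵥ u - r * (u ⬝ᵥ u) := by
      simp [hz, dotProduct_sub, dotProduct_smul]
    have hEu : E *ᵥ u = z + r • u := by simp [hz]
    -- `(a - r) ⟨u, z⟩ ≤ ⟨z, z⟩ ≤ (b - r) ⟨u, z⟩`
    have hlow : (a - r) * (u ⬝ᵥ z) ≤ z ⬝ᵥ z := by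
      have h := dotProduct_self_nonneg_real (z - (a - r) • u)
      simp only [dotProduct_sub, sub_dotProduct, dotProduct_smul, smul_dotProduct,
        smul_eq_mul, dotProduct_comm z u] at h
      nlinarith [ha u]
    have hupp : z ⬝ᵥ z ≤ (b - r) * (u ⬝ᵥ z) := by
      have hbr : 0 < b - r := by linarith
      have h := ha ((b - r) • u - z)
      have h0 := dotProduct_self_nonneg_real ((b - r) • u - z)
      have hs := hE.dotProduct_mulVec_swap z u
      have hbz := hb z
      have hnn : r * (((b - r) • u - z) ⬝ᵥ ((b - r) • u - z)) ≤
          ((b - r) • u - z) ⬝ᵥ E *ᵥ ((b - r) • u - z) := by nlinarith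
      simp only [mulVec_sub, mulVec_smul, dotProduct_sub, sub_dotProduct, dotProduct_smul,
        smul_dotProduct, smul_eq_mul, ← hs] at hnn
      rw [hEu] at hnn
      simp only [dotProduct_add, dotProduct_smul, smul_eq_mul, dotProduct_comm z u] at hnn
      have : 0 ≤ (b - r) * ((b - r) * (u ⬝ᵥ z) - z ⬝ᵥ z) := by nlinarith
      have := nonneg_of_mul_nonneg_right this hbr
      linarith
    have hpw := hp w
    have hqw := hq w
    rw [hzR] at hpw hqw
    have hcw := hc w
    have hdw := hd w
    constructor
    · apply lamM_le_of_mul_le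
      have : ((r - a) * (r + d)) * (w ⬝ᵥ w) ≤ q * (w ⬝ᵥ w) := by nlinarith
      exact le_of_mul_le_mul_right this hww
    · apply le_lamM_of_le_mul hp0 (by linarith)
      have : p * (w ⬝ᵥ w) ≤ ((r - b) * (r + c)) * (w ⬝ᵥ w) := by nlinarith
      exact le_of_mul_le_mul_right this hww
  · right
    refine ⟨hra, le_lamP_of_mul_le ?_⟩
    rcases le_or_gt r b with hrb | hrb
    · nlinarith [mul_nonneg (sub_nonneg.mpr hrb) (add_nonneg (ha0.trans hra) hc0)]
    · have hbu := hb u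
      have hcw := hc w
      have hqw := hq w
      have hrc : 0 < r + c := by linarith
      have hw : w ≠ 0 := by
        rintro rfl
        have hu : u ≠ 0 := by simpa using huw
        have := dotProduct_self_pos_of_ne_zero hu
        simp at key
        nlinarith
      have hww := dotProduct_self_pos_of_ne_zero hw
      set z := r • u - E *ᵥ u with hz
      rw [hRw] at hqw
      have huz : u ⬝ᵥ z = r * (u ⬝ᵥ u) - u ⬝ᵥ E *ᵥ u := by
        simp [hz, dotProduct_sub, dotProduct_smul]
      have hlow : (r - b) * (u ⬝ᵥ z) ≤ z ⬝ᵥ z := by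
        have h := dotProduct_self_nonneg_real (z - (r - b) • u)
        simp only [dotProduct_sub, sub_dotProduct, dotProduct_smul, smul_dotProduct,
          smul_eq_mul, dotProduct_comm z u] at h
        nlinarith
      have : ((r - b) * (r + c)) * (w ⬝ᵥ w) ≤ q * (w ⬝ᵥ w) := by nlinarith
      exact le_of_mul_le_mul_right this hww

/-- A complex generalized eigenvalue of a real symmetric pencil `(A, S)` with `S` positive definite
is real and has a real eigenvector. -/
lemma exists_real_generalized_eigenvector {ι : Type*} [Fintype ι] {A S : Matrix ι ι ℝ}
    (hA : A.IsHermitian) (hS : S.PosDef) {lam : ℂ} {v : ι → ℂ} (hv : v ≠ 0)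
    (h : (A.map (fun x : ℝ => (x : ℂ))) *ᵥ v = lam • (S.map (fun x : ℝ => (x : ℂ))) *ᵥ v) :
    lam = (lam.re : ℂ) ∧ ∃ x : ι → ℝ, x ≠ 0 ∧ A *ᵥ x = lam.re • S *ᵥ x := by
  set p : ι → ℝ := fun i => (v i).re with hp
  set q : ι → ℝ := fun i => (v i).im with hq
  have hre : ∀ (M : Matrix ι ι ℝ) i,
      ((M.map (fun x : ℝ => (x : ℂ)) *ᵥ v) i).re = (M *ᵥ p) i := fun M i => by
    simp [mulVec, dotProduct, hp]
  have him : ∀ (M : Matrix ι ι ℝ) i,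
      ((M.map (fun x : ℝ => (x : ℂ)) *ᵥ v) i).im = (M *ᵥ q) i := fun M i => by
    simp [mulVec, dotProduct, hq]
  have h1 : A *ᵥ p = lam.re • S *ᵥ p - lam.im • S *ᵥ q := by
    ext i
    have := congrArg Complex.re (congrFun h i)
    simpa only [hre, him, Pi.smul_apply, smul_eq_mul, Complex.mul_re, Pi.sub_apply] using this
  have h2 : A *ᵥ q = lam.re • S *ᵥ q + lam.im • S *ᵥ p := by
    ext i
    have := congrArg Complex.im (congrFun h i)
    simpa only [hre, him, Pi.smul_apply, smul_eq_mul, Complex.mul_im, Pi.add_apply] using this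
  have hpq : p ≠ 0 ∨ q ≠ 0 := by
    by_contra! hcon
    exact hv (funext fun i => Complex.ext (congrFun hcon.1 i) (congrFun hcon.2 i))
  have hpos : 0 < p ⬝ᵥ S *ᵥ p + q ⬝ᵥ S *ᵥ q := by
    have hnn : ∀ x, 0 ≤ x ⬝ᵥ S *ᵥ x := fun x => by
      simpa using hS.posSemidef.dotProduct_mulVec_nonneg x
    have hps : ∀ x, x ≠ 0 → 0 < x ⬝ᵥ S *ᵥ x := fun x hx => by
      simpa using hS.dotProduct_mulVec_pos hx
    rcases hpq with hx | hx
    · exact add_pos_of_pos_of_nonneg (hps p hx) (hnn q)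
    · exact add_pos_of_nonneg_of_pos (hnn p) (hps q hx)
  have him0 : lam.im = 0 := by
    have hs := hA.dotProduct_mulVec_swap p q
    have hs' := hS.1.dotProduct_mulVec_swap p q
    rw [h1, h2] at hs
    simp only [dotProduct_add, dotProduct_sub, dotProduct_smul, smul_eq_mul, hs'] at hs
    have : lam.im * (p ⬝ᵥ S *ᵥ p + q ⬝ᵥ S *ᵥ q) = 0 := by linarith
    exact (mul_eq_zero.mp this).resolve_right hpos.ne'
  refine ⟨Complex.ext rfl (by simpa using him0), ?_⟩
  rcases hpq with hx | hx
  · exact ⟨p, hx, by simpa [him0] using h1⟩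
  · exact ⟨q, hx, by simpa [him0] using h2⟩

/-- every eigenvalue `λ` of `𝒫̂_SP⁻¹ 𝒜_SP` (over `ℂ`) is real and lies in
`[λ₋(α_E⁰, β_E¹, β_R¹), λ₋(β_E⁰, α_E¹, α_R¹)] ∪ [α_E⁰, λ₊(β_E⁰, α_E¹, β_R¹)]`.
Here `Q0 = Ŝ₀^{1/2}`, `Q1 = Ŝ₁^{1/2}` are the symmetric positive definite square roots,
`E_i = Ŝ_i^{-1/2} A_i Ŝ_i^{-1/2}`, `R₁ = Ŝ₁^{-1/2} B₁ Ŝ₀^{-1/2}`, and `α/β` are min/max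
eigenvalues. -/
theorem stmt6 (n0 n1 : ℕ) (hn1 : 0 < n1) (hle : n1 ≤ n0)
    (A0 : Matrix (Fin n0) (Fin n0) ℝ) (A1 : Matrix (Fin n1) (Fin n1) ℝ)
    (B1 : Matrix (Fin n1) (Fin n0) ℝ)
    (hA0 : A0.PosDef) (hA1 : A1.PosSemidef) (hB1 : B1.rank = n1)
    (S0 : Matrix (Fin n0) (Fin n0) ℝ) (S1 : Matrix (Fin n1) (Fin n1) ℝ)
    (hS0 : S0.PosDef) (hS1 : S1.PosDef)
    (Q0 : Matrix (Fin n0) (Fin n0) ℝ) (hQ0 : Q0.PosDef) (hQ0sq : Q0 * Q0 = S0)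
    (Q1 : Matrix (Fin n1) (Fin n1) ℝ) (hQ1 : Q1.PosDef) (hQ1sq : Q1 * Q1 = S1)
    (hE0 : (Q0⁻¹ * A0 * Q0⁻¹).IsHermitian)
    (hE1 : (Q1⁻¹ * A1 * Q1⁻¹).IsHermitian)
    (hR1 : ((Q1⁻¹ * B1 * Q0⁻¹) * (Q1⁻¹ * B1 * Q0⁻¹)ᵀ).IsHermitian)
    (αE0 βE0 αE1 βE1 αR1 βR1 : ℝ)
    (hαE0 : αE0 = ⨅ i, hE0.eigenvalues i) (hβE0 : βE0 = ⨆ i, hE0.eigenvalues i)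
    (hαE1 : αE1 = ⨅ i, hE1.eigenvalues i) (hβE1 : βE1 = ⨆ i, hE1.eigenvalues i)
    (hαR1 : αR1 = ⨅ i, hR1.eigenvalues i) (hβR1 : βR1 = ⨆ i, hR1.eigenvalues i)
    (lam : ℂ)
    (hlam : ∃ v : (Fin n0 ⊕ Fin n1) → ℂ, v ≠ 0 ∧
      ((Matrix.fromBlocks A0 B1ᵀ B1 (-A1)).map (fun x : ℝ => (x : ℂ))).mulVec v =
        lam • ((Matrix.fromBlocks S0 0 0 S1).map (fun x : ℝ => (x : ℂ))).mulVec v) :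
    ∃ r : ℝ, lam = (r : ℂ) ∧
      ((lamM αE0 βE1 βR1 ≤ r ∧ r ≤ lamM βE0 αE1 αR1) ∨
        (αE0 ≤ r ∧ r ≤ lamP βE0 αE1 βR1)) := by
  obtain ⟨v, hv, hvl⟩ := hlam
  have hS : (fromBlocks S0 0 0 S1).PosDef := by
    refine .of_dotProduct_mulVec_pos
      (hS0.1.fromBlocks (by simp) hS1.1) fun x hx => ?_
    obtain ⟨y, z, rfl⟩ : ∃ y z, x = Sum.elim y z := ⟨_, _, (Sum.elim_comp_inl_inr x).symm⟩
    have hyz : y ≠ 0 ∨ z ≠ 0 := by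
      by_contra! hcon
      exact hx (by ext (i | i) <;> simp [hcon])
    have hy := hS0.posSemidef.dotProduct_mulVec_nonneg y
    have hz := hS1.posSemidef.dotProduct_mulVec_nonneg z
    have heq : star (Sum.elim y z) ⬝ᵥ fromBlocks S0 0 0 S1 *ᵥ Sum.elim y z =
        star y ⬝ᵥ S0 *ᵥ y + star z ⬝ᵥ S1 *ᵥ z := by
      simp [fromBlocks_mulVec]
    rw [heq]
    rcases hyz with h | h
    · exact add_pos_of_pos_of_nonneg (hS0.dotProduct_mulVec_pos h) hz
    · exact add_pos_of_nonneg_of_pos hy (hS1.dotProduct_mulVec_pos h)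
  have hA : (fromBlocks A0 B1ᵀ B1 (-A1)).IsHermitian :=
    hA0.1.fromBlocks (by simp) hA1.1.neg
  obtain ⟨hreal, x, hx, hxe⟩ := exists_real_generalized_eigenvector hA hS hv hvl
  obtain ⟨y, z, rfl⟩ : ∃ y z, x = Sum.elim y z := ⟨_, _, (Sum.elim_comp_inl_inr x).symm⟩
  refine ⟨lam.re, hreal, ?_⟩
  have hyz : y ≠ 0 ∨ z ≠ 0 := by
    by_contra! hcon
    exact hx (by ext (i | i) <;> simp [hcon])
  have hd0 : IsUnit Q0.det := hQ0.det_pos.ne'.isUnit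
  have hd1 : IsUnit Q1.det := hQ1.det_pos.ne'.isUnit
  have ht0 : Q0⁻¹ᴴ = Q0⁻¹ := hQ0.1.inv.eq
  have ht1 : Q1⁻¹ᴴ = Q1⁻¹ := hQ1.1.inv.eq
  have e1 : A0 *ᵥ y + B1ᵀ *ᵥ z = lam.re • S0 *ᵥ y := by
    ext i
    simpa [fromBlocks_mulVec] using congrFun hxe (Sum.inl i)
  have e2 : B1 *ᵥ y - A1 *ᵥ z = lam.re • S1 *ᵥ z := by
    ext i
    simpa [fromBlocks_mulVec, neg_mulVec, sub_eq_add_neg] using congrFun hxe (Sum.inr i)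
  have : Nonempty (Fin n1) := ⟨⟨0, hn1⟩⟩
  have : Nonempty (Fin n0) := ⟨⟨0, hn1.trans_le hle⟩⟩
  have hpsE0 : (Q0⁻¹ * A0 * Q0⁻¹).PosSemidef := by
    have := hA0.posSemidef.mul_mul_conjTranspose_same Q0⁻¹
    rwa [ht0] at this
  have hpsE1 : (Q1⁻¹ * A1 * Q1⁻¹).PosSemidef := by
    have := hA1.mul_mul_conjTranspose_same Q1⁻¹
    rwa [ht1] at this
  set R := Q1⁻¹ * B1 * Q0⁻¹ with hR
  have hpsR : (R * Rᵀ).PosSemidef := by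
    simpa [conjTranspose_eq_transpose_of_trivial] using posSemidef_self_mul_conjTranspose R
  have hRR : ∀ t, t ⬝ᵥ (R * Rᵀ) *ᵥ t = (Rᵀ *ᵥ t) ⬝ᵥ (Rᵀ *ᵥ t) := fun t => by
    rw [← mulVec_mulVec, dotProduct_mulVec, ← mulVec_transpose]
  have hαle {n : ℕ} (f : Fin n → ℝ) (i : Fin n) : ⨅ i, f i ≤ f i :=
    ciInf_le (Set.finite_range f).bddBelow i
  have hβge {n : ℕ} (f : Fin n → ℝ) (i : Fin n) : f i ≤ ⨆ i, f i :=
    le_ciSup (Set.finite_range f).bddAbove i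
  subst hαE0 hβE0 hαE1 hβE1 hαR1 hβR1
  have hRt : Rᵀ = Q0⁻¹ * B1ᵀ * Q1⁻¹ := by
    rw [conjTranspose_eq_transpose_of_trivial] at ht0 ht1
    rw [hR, transpose_mul, transpose_mul, ht0, ht1, Matrix.mul_assoc]
  refine saddle_eigenvalue_bounds (E := Q0⁻¹ * A0 * Q0⁻¹) (F := Q1⁻¹ * A1 * Q1⁻¹) (R := R)
    (u := Q0 *ᵥ y) (w := Q1 *ᵥ z) hE0
    (hE0.mul_dotProduct_le (hαle _)) (hE0.dotProduct_le_mul (hβge _))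
    (hE1.mul_dotProduct_le (hαle _)) (hE1.dotProduct_le_mul (hβge _))
    (fun t => by rw [← hRR]; exact hR1.mul_dotProduct_le (hαle _) t)
    (fun t => by rw [← hRR]; exact hR1.dotProduct_le_mul (hβge _) t)
    ((hαle _ (Classical.arbitrary _)).trans (hβge _ _))
    (le_ciInf hpsE0.eigenvalues_nonneg) (le_ciInf hpsE1.eigenvalues_nonneg)
    (le_ciInf hpsR.eigenvalues_nonneg)
    ((hpsR.eigenvalues_nonneg (Classical.arbitrary _)).trans (hβge _ _)) ?_ ?_ ?_
  · refine hyz.imp (fun h h' => h ?_) (fun h h' => h ?_)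
    · simpa [nonsing_inv_mul _ hd0] using congrArg (Q0⁻¹ *ᵥ ·) h'
    · simpa [nonsing_inv_mul _ hd1] using congrArg (Q1⁻¹ *ᵥ ·) h'
  · have := congrArg (Q0⁻¹ *ᵥ ·) e1
    simp only [mulVec_add, mulVec_smul, ← hQ0sq, mulVec_mulVec] at this
    rw [← Matrix.mul_assoc Q0⁻¹ Q0, nonsing_inv_mul _ hd0, Matrix.one_mul] at this
    rw [hRt, mulVec_mulVec, mulVec_mulVec, Matrix.mul_assoc, nonsing_inv_mul _ hd0,
      Matrix.mul_assoc _ _ Q1, nonsing_inv_mul _ hd1, Matrix.mul_one, Matrix.mul_one, this]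
  · have := congrArg (Q1⁻¹ *ᵥ ·) e2
    simp only [mulVec_sub, mulVec_smul, ← hQ1sq, mulVec_mulVec] at this
    rw [← Matrix.mul_assoc Q1⁻¹ Q1, nonsing_inv_mul _ hd1, Matrix.one_mul] at this
    rw [hR, mulVec_mulVec, mulVec_mulVec, Matrix.mul_assoc, nonsing_inv_mul _ hd0,
      Matrix.mul_assoc _ _ Q1, nonsing_inv_mul _ hd1, Matrix.mul_one, Matrix.mul_one, this]
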